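/- arXiv:1208.6229 — 2 statements merged into one kernel-verified Lean document; each statement's English description precedes it below -/
import Mathlib

section
/- Let f ∈ ℓ¹(ℤⁿ) and suppose the twisted-convolution operator λ(f) : g ↦ f ♮ g is invertible as a bounded operator on ℓ²(ℤⁿ). Then there exists g ∈ ℓ¹(ℤⁿ) with f ♮ g = g ♮ f = δ_0; in particular the inverse operator λ(f)⁻¹ equals λ(g). (Equivalently, the Banach *-algebra ℓ¹(ℤⁿ, θ) is inverse-closed in the non-commutative torus C*(θ).) -/
open scoped BigOperators
open Filter Topology

noncomputable section

/-- The cocycle σ(l,m) = ∏_{1 ≤ j < k ≤ n} θ_{k,j}^{l_k m_j}. -/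
def coc {n : ℕ} (θ : Fin n → Fin n → ℂ) (l m : Fin n → ℤ) : ℂ :=
  ∏ p ∈ Finset.univ.filter (fun p : Fin n × Fin n => p.1 < p.2), θ p.2 p.1 ^ (l p.2 * m p.1)

/-- Twisted convolution (f ♮ g)(x) = Σ_y f(y) g(x−y) σ(y, x−y). -/
def tconv {n : ℕ} (σ : (Fin n → ℤ) → (Fin n → ℤ) → ℂ) (f g : (Fin n → ℤ) → ℂ) :
    (Fin n → ℤ) → ℂ :=
  fun x => ∑' y, f y * g (x - y) * σ y (x - y)

/-- δ_y, the indicator of {y}. -/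
def delta {n : ℕ} (y : Fin n → ℤ) : (Fin n → ℤ) → ℂ := fun x => if x = y then 1 else 0

/-- ℓ²(ℤⁿ). -/
abbrev Ltwo (n : ℕ) := lp (fun _ : Fin n → ℤ => ℂ) 2

/-- **Schur's lemma** for Banach algebras: modulo a maximal left ideal, a central element is a
scalar. -/
theorem Ideal.IsMaximal.exists_sub_algebraMap_mem {R : Type*} [NormedRing R] [NormedAlgebra ℂ R]
    [CompleteSpace R] {M : Ideal R} (hM : M.IsMaximal) {z : R} (hz : ∀ r, Commute z r) :
    ∃ c : ℂ, z - algebraMap ℂ R c ∈ M := by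
  have hMcl : IsClosed (M : Set R) := hM.isClosed
  let N : Submodule ℂ R := M.restrictScalars ℂ
  have hNcl : IsClosed (N : Set R) := hMcl
  have hmem : ∀ r, r ∈ N ↔ r ∈ M := fun r => Iff.rfl
  have hNtop : N ≠ ⊤ := fun h => hM.ne_top <| by
    rw [Ideal.eq_top_iff_one, ← hmem, h]; trivial
  have : Nontrivial (R ⧸ N) := Submodule.Quotient.nontrivial_iff.2 hNtop
  have hle : N ≤ N.comap (LinearMap.mulLeft ℂ z) := fun r hr => by
    change z * r ∈ M
    exact M.mul_mem_left z hr
  let Z : (R ⧸ N) →L[ℂ] (R ⧸ N) :=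
    { toLinearMap := N.mapQ N (LinearMap.mulLeft ℂ z) hle
      cont := by
        refine Continuous.quotient_lift (f := fun r : R => N.mkQ (z * r)) ?_ _
        exact (continuous_quot_mk.comp (continuous_const.mul continuous_id)) }
  obtain ⟨c, hc⟩ := spectrum.nonempty Z
  refine ⟨c, ?_⟩
  by_contra hzM
  set w := z - algebraMap ℂ R c with hw
  have hwc : ∀ r, w * r = r * w := fun r => by
    rw [hw, sub_mul, mul_sub, (hz r).eq, Algebra.commutes]
  have hspan : ∀ r, r ∉ M → ∃ s, ∃ m ∈ M, s * r + m = 1 := fun r hr => by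
    have := (Ideal.eq_top_iff_one _).1 (hM.1.2 (M ⊔ Ideal.span {r}) (by
      refine lt_of_le_of_ne le_sup_left fun h => hr ?_
      rw [h]; exact Ideal.mem_sup_right (Ideal.mem_span_singleton_self r)))
    obtain ⟨m, hm, t, ht, h1⟩ := Submodule.mem_sup.1 this
    obtain ⟨s, rfl⟩ := Ideal.mem_span_singleton'.1 ht
    exact ⟨s, m, hm, by rw [add_comm]; exact h1⟩
  let W : (R ⧸ N) →L[ℂ] (R ⧸ N) := Z - algebraMap ℂ _ c
  have hW : ∀ r : R, W (Submodule.Quotient.mk r) = Submodule.Quotient.mk (w * r) := fun r => by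
    rw [hw, sub_mul, Submodule.Quotient.mk_sub, ← Algebra.smul_def, Submodule.Quotient.mk_smul]
    rfl
  have hWbij : Function.Bijective W := by
    constructor
    · refine (injective_iff_map_eq_zero W).2 fun q hq => ?_
      obtain ⟨r, rfl⟩ := Submodule.Quotient.mk_surjective _ q
      rw [hW, Submodule.Quotient.mk_eq_zero] at hq
      rw [Submodule.Quotient.mk_eq_zero]
      by_contra hr
      obtain ⟨s, m, hm, h1⟩ := hspan r hr
      apply hzM
      have : w = s * (w * r) + w * m := by
        rw [← mul_assoc, ← hwc s, mul_assoc, ← mul_add, h1, mul_one]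
      rw [this]
      exact M.add_mem (M.mul_mem_left _ hq) (M.mul_mem_left _ hm)
    · intro q
      obtain ⟨r, rfl⟩ := Submodule.Quotient.mk_surjective _ q
      obtain ⟨s, m, hm, h1⟩ := hspan w hzM
      refine ⟨Submodule.Quotient.mk (r * s), ?_⟩
      rw [hW, Submodule.Quotient.eq]
      have : w * (r * s) - r = - (r * m) := by
        rw [hwc, mul_assoc, eq_sub_of_add_eq h1]; noncomm_ring
      rw [this]
      exact M.neg_mem (M.mul_mem_left _ hm)
  apply hc
  have hu : IsUnit W := ContinuousLinearMap.isUnit_iff_bijective.2 hWbij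
  rw [spectrum.mem_resolventSet_iff]
  simpa [W] using hu.neg

/-- The **Bochner–Phillips theorem**, left-sided form: an absolutely convergent Fourier series with
coefficients `a x` in a Banach algebra, evaluated at a bounded central representation `c` of `G`,
is left invertible as soon as all its evaluations at unitary characters are. -/
theorem exists_mul_tsum_eq_one {R G : Type*} [NormedRing R] [NormedAlgebra ℂ R]
    [CompleteSpace R] [AddGroup G] (c : G → R) (h0 : c 0 = 1)
    (hadd : ∀ x y, c (x + y) = c x * c y) (hnorm : ∀ x, ‖c x‖ ≤ 1) (hc : ∀ x r, Commute (c x) r)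
    (a : G → R) (ha : Summable fun x => ‖a x‖)
    (hinv : ∀ χ : G → ℂ, χ 0 = 1 → (∀ x y, χ (x + y) = χ x * χ y) → (∀ x, ‖χ x‖ = 1) →
      ∃ r, r * ∑' x, χ x • a x = 1) :
    ∃ b, b * ∑' x, a x * c x = 1 := by
  by_contra! hne
  set A := ∑' x, a x * c x with hA
  have hproper : Ideal.span {A} ≠ ⊤ := fun h => by
    obtain ⟨b, hb⟩ := Ideal.mem_span_singleton'.1 ((Ideal.eq_top_iff_one _).1 h)
    exact hne b hb
  obtain ⟨M, hM, hAM⟩ := Ideal.exists_le_maximal _ hproper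
  have hAM : A ∈ M := hAM (Ideal.mem_span_singleton_self A)
  have hMcl : IsClosed (M : Set R) := hM.isClosed
  choose χ hχ using fun x => hM.exists_sub_algebraMap_mem (hc x)
  have halg : ∀ d : ℂ, algebraMap ℂ R d ∈ M → d = 0 := fun d hd => by
    by_contra hd0
    exact hM.ne_top (M.eq_top_of_isUnit_mem hd ((IsUnit.mk0 d hd0).map (algebraMap ℂ R)))
  have hχ0 : χ 0 = 1 := by
    have := hχ 0
    rw [h0, ← map_one (algebraMap ℂ R), ← map_sub] at this
    exact (sub_eq_zero.1 (halg _ this)).symm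
  have hχadd : ∀ x y, χ (x + y) = χ x * χ y := fun x y => by
    refine sub_eq_zero.1 (halg _ ?_)
    have h1 := M.mul_mem_left (c x) (hχ y)
    have h2 := M.mul_mem_left (algebraMap ℂ R (χ y)) (hχ x)
    have h3 := M.sub_mem (M.add_mem h1 h2) (hχ (x + y))
    convert h3 using 1
    rw [hadd, map_sub, map_mul, mul_sub, mul_sub, (hc x (algebraMap ℂ R (χ y))).eq,
      Algebra.commutes (χ y) (algebraMap ℂ R (χ x))]
    abel
  have hR1 : (1 : R) ≠ 0 := fun h => hM.ne_top ((Ideal.eq_top_iff_one _).2 (h ▸ M.zero_mem))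
  have : Nontrivial R := ⟨1, 0, hR1⟩
  have hle : ∀ x, ‖χ x‖ ≤ 1 := by
    have hb : ∀ x, ‖χ x‖ ≤ ‖(1 : R)‖ := fun x => by
      by_contra! hlt
      have : χ x ∈ resolventSet ℂ (c x) := by
        refine spectrum.mem_resolventSet_of_norm_lt_mul (lt_of_le_of_lt ?_ hlt)
        simpa using mul_le_mul_of_nonneg_right (hnorm x) (norm_nonneg (1 : R))
      rw [spectrum.mem_resolventSet_iff] at this
      refine hM.ne_top (M.eq_top_of_isUnit_mem (hχ x) ?_)
      simpa using this.neg
    intro x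
    by_contra! hlt
    have hpow : ∀ k : ℕ, χ (k • x) = χ x ^ k := fun k => by
      induction k with
      | zero => simp [hχ0]
      | succ k ih => rw [succ_nsmul, hχadd, ih, pow_succ]
    obtain ⟨k, hk⟩ := pow_unbounded_of_one_lt ‖(1 : R)‖ hlt
    have := hb (k • x)
    rw [hpow, norm_pow] at this
    linarith
  have hone : ∀ x, ‖χ x‖ = 1 := fun x => by
    refine le_antisymm (hle x) ?_
    have : ‖χ x‖ * ‖χ (-x)‖ = 1 := by rw [← norm_mul, ← hχadd, add_neg_cancel, hχ0, norm_one]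
    nlinarith [hle (-x), norm_nonneg (χ x), norm_nonneg (χ (-x))]
  obtain ⟨r, hr⟩ := hinv χ hχ0 hχadd hone
  have hs1 : Summable fun x => a x * c x := .of_norm_bounded ha fun x =>
    (norm_mul_le _ _).trans (mul_le_of_le_one_right (norm_nonneg _) (hnorm x))
  have hs2 : Summable fun x => χ x • a x := .of_norm_bounded ha fun x => by
    rw [norm_smul, hone, one_mul]
  have hdiff : A - ∑' x, χ x • a x ∈ M := by
    rw [hA, ← hs1.tsum_sub hs2]
    refine hMcl.mem_of_tendsto (hs1.sub hs2).hasSum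
      (Eventually.of_forall fun s => M.sum_mem fun x _ => ?_)
    rw [Algebra.smul_def, Algebra.commutes, ← mul_sub]
    exact M.mul_mem_left _ (hχ x)
  refine hM.ne_top ((Ideal.eq_top_iff_one _).2 ?_)
  rw [← hr]
  exact M.mul_mem_left _ (by simpa using M.sub_mem hAM hdiff)

/-- The **Bochner–Phillips theorem**, right-sided form. -/
theorem exists_tsum_mul_eq_one {R G : Type*} [NormedRing R] [NormedAlgebra ℂ R]
    [CompleteSpace R] [AddCommGroup G] (c : G → R) (h0 : c 0 = 1)
    (hadd : ∀ x y, c (x + y) = c x * c y) (hnorm : ∀ x, ‖c x‖ ≤ 1) (hc : ∀ x r, Commute (c x) r)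
    (a : G → R) (ha : Summable fun x => ‖a x‖)
    (hinv : ∀ χ : G → ℂ, χ 0 = 1 → (∀ x y, χ (x + y) = χ x * χ y) → (∀ x, ‖χ x‖ = 1) →
      ∃ r, (∑' x, χ x • a x) * r = 1) :
    ∃ b, (∑' x, a x * c x) * b = 1 := by
  obtain ⟨b, hb⟩ := exists_mul_tsum_eq_one (R := Rᵐᵒᵖ) (fun x => .op (c x)) (by simp [h0])
    (fun x y => by rw [add_comm, hadd, MulOpposite.op_mul])
    (fun x => (MulOpposite.norm_op _).trans_le (hnorm x))
    (fun x r => (hc x r.unop).op) (fun x => .op (a x))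
    (by simpa only [MulOpposite.norm_op] using ha)
    (fun χ h1 h2 h3 => by
      obtain ⟨r, hr⟩ := hinv χ h1 h2 h3
      refine ⟨.op r, ?_⟩
      rw [← MulOpposite.op_one, ← hr, MulOpposite.op_mul, ← MulOpposite.opHomeomorph_apply]
      simp [← MulOpposite.op_smul, tsum_op])
  refine ⟨b.unop, ?_⟩
  have := congrArg MulOpposite.unop hb
  rw [MulOpposite.unop_mul, MulOpposite.unop_one] at this
  rw [← this, ← MulOpposite.unop_op (∑' x, a x * c x)]
  congr 2
  rw [← tsum_op]
  refine tsum_congr fun x => ?_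
  rw [← MulOpposite.op_mul, (hc x _).eq]

/-- The operator `v ↦ (i ↦ S i (v (e i)))` on `ℓᵖ`, for a permutation `e` and a bounded family `S`
of operators. -/
def lpPermCLM {I F : Type*} [NormedAddCommGroup F] [NormedSpace ℂ F] (p : ENNReal)
    [Fact (1 ≤ p)] (hp : p ≠ ⊤) (e : I ≃ I) (S : I → F →L[ℂ] F) (C : ℝ) (hC : 0 ≤ C)
    (hS : ∀ i, ‖S i‖ ≤ C) :
    lp (fun _ : I => F) p →L[ℂ] lp (fun _ : I => F) p :=
  have hp0 : 0 < p.toReal := ENNReal.toReal_pos (zero_lt_one.trans_le Fact.out).ne' hp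
  have hle : ∀ (v : lp (fun _ : I => F) p) (i : I),
      ‖S i (v (e i))‖ ^ p.toReal ≤ C ^ p.toReal * ‖v (e i)‖ ^ p.toReal := fun v i => by
    rw [← Real.mul_rpow hC (norm_nonneg _)]
    exact Real.rpow_le_rpow (norm_nonneg _)
      ((S i).le_of_opNorm_le (hS i) _) hp0.le
  have hsum : ∀ v : lp (fun _ : I => F) p,
      HasSum (fun i => C ^ p.toReal * ‖v (e i)‖ ^ p.toReal) (C ^ p.toReal * ‖v‖ ^ p.toReal) :=
    fun v => (e.hasSum_iff.2 (lp.hasSum_norm hp0 v)).mul_left _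
  LinearMap.mkContinuous
    { toFun := fun v => ⟨fun i => S i (v (e i)), memℓp_gen <|
        (hsum v).summable.of_nonneg_of_le (fun i => by positivity) (hle v)⟩
      map_add' := fun v w => lp.ext <| funext fun i => map_add (S i) _ _
      map_smul' := fun k v => lp.ext <| funext fun i => map_smul (S i) _ _ }
    C fun v => by
      refine lp.norm_le_of_tsum_le hp0 (by positivity) ?_
      rw [Real.mul_rpow hC (norm_nonneg _), ← (hsum v).tsum_eq]
      exact Summable.tsum_le_tsum (hle v)
        ((hsum v).summable.of_nonneg_of_le (fun i => by positivity) (hle v)) (hsum v).summable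

section lpPermCLM

variable {I F : Type*} [NormedAddCommGroup F] [NormedSpace ℂ F] {p : ENNReal}
    [Fact (1 ≤ p)] (hp : p ≠ ⊤) (e : I ≃ I) (S : I → F →L[ℂ] F) {C : ℝ} (hC : 0 ≤ C)
    (hS : ∀ i, ‖S i‖ ≤ C)

theorem norm_lpPermCLM_le : ‖lpPermCLM p hp e S C hC hS‖ ≤ C :=
  ContinuousLinearMap.opNorm_le_bound _ hC fun v => by
    unfold lpPermCLM
    exact (LinearMap.mkContinuous _ C _).le_of_opNorm_le (LinearMap.mkContinuous_norm_le _ hC _) v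

end lpPermCLM

/-- Translation by `x` on `ℓ¹(G, H)`. -/
def lpTranslate {G : Type*} (H : Type*) [AddCommGroup G] [NormedAddCommGroup H] [NormedSpace ℂ H]
    (x : G) : lp (fun _ : G => H) 1 →L[ℂ] lp (fun _ : G => H) 1 :=
  lpPermCLM 1 ENNReal.one_ne_top (Equiv.subRight x) (fun _ => .id ℂ H) 1 zero_le_one
    fun _ => ContinuousLinearMap.norm_id_le

/-- The bounded operators on `ℓ¹(G, H)` which commute with translations. -/
abbrev TranslationCommutant (G H : Type*) [AddCommGroup G] [NormedAddCommGroup H]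
    [NormedSpace ℂ H] : Subalgebra ℂ (lp (fun _ : G => H) 1 →L[ℂ] lp (fun _ : G => H) 1) :=
  Subalgebra.centralizer ℂ (Set.range (lpTranslate (G := G) H))

section TranslationCommutant

variable {G H : Type*} [AddCommGroup G] [NormedAddCommGroup H] [NormedSpace ℂ H]

@[simp]
theorem lpTranslate_apply (x : G) (v : lp (fun _ : G => H) 1) (y : G) :
    lpTranslate H x v y = v (y - x) := rfl

theorem norm_lpTranslate_le (x : G) : ‖lpTranslate H x‖ ≤ 1 :=
  norm_lpPermCLM_le ENNReal.one_ne_top (Equiv.subRight x) (fun _ => .id ℂ H) zero_le_one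
    fun _ => ContinuousLinearMap.norm_id_le

theorem lpTranslate_add (x y : G) :
    lpTranslate H (x + y) = lpTranslate H x * lpTranslate H y := by
  refine ContinuousLinearMap.ext fun v => lp.ext <| funext fun z => ?_
  rw [mul_apply_eq_comp]
  simp only [lpTranslate_apply, sub_add_eq_sub_sub]

/-- Translations, as elements of their own commutant. -/
def TranslationCommutant.translate (x : G) : TranslationCommutant G H :=
  ⟨lpTranslate H x, Subalgebra.mem_centralizer_iff ℂ |>.2 <| by
    rintro _ ⟨y, rfl⟩
    rw [← lpTranslate_add, ← lpTranslate_add, add_comm]⟩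

theorem TranslationCommutant.commute_translate (x : G) (r : TranslationCommutant G H) :
    Commute (translate x) r :=
  Subtype.ext <| (Subalgebra.mem_centralizer_iff ℂ).1 r.2 _ ⟨x, rfl⟩

instance [CompleteSpace H] : CompleteSpace (TranslationCommutant G H) :=
  (Set.isClosed_centralizer _).completeSpace_coe

/-- The pointwise action of an operator on `H` on `ℓ¹(G, H)`. -/
def lpPointwise (G : Type*) [AddCommGroup G] (S : H →L[ℂ] H) :
    lp (fun _ : G => H) 1 →L[ℂ] lp (fun _ : G => H) 1 :=
  lpPermCLM 1 ENNReal.one_ne_top (Equiv.refl G) (fun _ => S) ‖S‖ (norm_nonneg _) fun _ => le_rfl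

theorem lpPointwise_one : lpPointwise G (1 : H →L[ℂ] H) = 1 :=
  ContinuousLinearMap.ext fun _ => lp.ext <| funext fun _ => rfl

theorem lpPointwise_mul (S S' : H →L[ℂ] H) :
    lpPointwise G (S * S') = lpPointwise G S * lpPointwise G S' :=
  ContinuousLinearMap.ext fun _ => lp.ext <| funext fun _ => rfl

theorem lpPointwise_add (S S' : H →L[ℂ] H) :
    lpPointwise G (S + S') = lpPointwise G S + lpPointwise G S' :=
  ContinuousLinearMap.ext fun _ => lp.ext <| funext fun _ => rfl

theorem lpPointwise_smul (k : ℂ) (S : H →L[ℂ] H) :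
    lpPointwise G (k • S) = k • lpPointwise G S :=
  ContinuousLinearMap.ext fun _ => lp.ext <| funext fun _ => rfl

theorem norm_lpPointwise_le (S : H →L[ℂ] H) : ‖lpPointwise G S‖ ≤ ‖S‖ :=
  norm_lpPermCLM_le ENNReal.one_ne_top (Equiv.refl G) (fun _ => S) (norm_nonneg _) fun _ => le_rfl

theorem lpTranslate_mul_lpPointwise (x : G) (S : H →L[ℂ] H) :
    lpTranslate H x * lpPointwise G S = lpPointwise G S * lpTranslate H x :=
  ContinuousLinearMap.ext fun _ => lp.ext <| funext fun _ => rfl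

/-- The pointwise action of operators on `H` on `ℓ¹(G, H)`, as an algebra homomorphism. -/
def TranslationCommutant.pointwise : (H →L[ℂ] H) →ₐ[ℂ] TranslationCommutant G H :=
  AlgHom.ofLinearMap
    { toFun := fun S => ⟨lpPointwise G S, (Subalgebra.mem_centralizer_iff ℂ).2 <| by
        rintro _ ⟨y, rfl⟩
        exact lpTranslate_mul_lpPointwise y S⟩
      map_add' := fun S S' => Subtype.ext (lpPointwise_add S S')
      map_smul' := fun k S => Subtype.ext (lpPointwise_smul k S) }
    (Subtype.ext lpPointwise_one) fun S S' => Subtype.ext (lpPointwise_mul S S')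

theorem TranslationCommutant.norm_pointwise_le (S : H →L[ℂ] H) :
    ‖pointwise (G := G) S‖ ≤ ‖S‖ :=
  norm_lpPointwise_le S

theorem TranslationCommutant.continuous_pointwise : Continuous (pointwise (G := G) (H := H)) :=
  AddMonoidHomClass.continuous_of_bound pointwise 1 fun S => by
    rw [one_mul]
    exact norm_pointwise_le S

/-- An absolutely convergent operator-valued Fourier series whose evaluations at unitary characters
are right invertible acts surjectively on `ℓ¹(G, H)` by convolution. -/
theorem exists_hasSum_of_forall_character [CompleteSpace H] (S : G → H →L[ℂ] H)
    (hS : Summable fun x => ‖S x‖)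
    (hinv : ∀ χ : G → ℂ, (∀ x y, χ (x + y) = χ x * χ y) → (∀ x, ‖χ x‖ = 1) →
      ∃ B, (∑' x, χ x • S x) * B = 1)
    (w : lp (fun _ : G => H) 1) :
    ∃ v : lp (fun _ : G => H) 1, ∀ y, HasSum (fun x => S x (v (y - x))) (w y) := by
  let c : G → TranslationCommutant G H := TranslationCommutant.translate
  let a : G → TranslationCommutant G H := fun x => TranslationCommutant.pointwise (S x)
  have ha : Summable fun x => ‖a x‖ :=
    hS.of_nonneg_of_le (fun _ => norm_nonneg _) fun x => TranslationCommutant.norm_pointwise_le _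
  have hnorm : ∀ x, ‖c x‖ ≤ 1 := norm_lpTranslate_le
  have h0 : c 0 = 1 := Subtype.ext <| ContinuousLinearMap.ext fun v => lp.ext <| funext fun y => by
    change v (y - 0) = v y
    rw [sub_zero]
  have hinv' : ∀ χ : G → ℂ, χ 0 = 1 → (∀ x y, χ (x + y) = χ x * χ y) → (∀ x, ‖χ x‖ = 1) →
      ∃ r, (∑' x, χ x • a x) * r = 1 := fun χ _ hadd hχ => by
    obtain ⟨B, hB⟩ := hinv χ hadd hχ
    refine ⟨TranslationCommutant.pointwise B, ?_⟩
    have hs : Summable fun x => χ x • S x := .of_norm_bounded hS fun x => by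
      rw [norm_smul, hχ, one_mul]
    have h1 : ∑' x, χ x • a x = TranslationCommutant.pointwise (∑' x, χ x • S x) := by
      rw [hs.map_tsum TranslationCommutant.pointwise TranslationCommutant.continuous_pointwise]
      exact tsum_congr fun x => (map_smul TranslationCommutant.pointwise _ _).symm
    rw [h1]
    exact (map_mul TranslationCommutant.pointwise _ _).symm.trans
      ((congrArg _ hB).trans (map_one TranslationCommutant.pointwise))
  obtain ⟨b, hb⟩ := exists_tsum_mul_eq_one c h0 (fun x y => Subtype.ext (lpTranslate_add x y))
    hnorm TranslationCommutant.commute_translate a ha hinv'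
  have hs : Summable fun x => a x * c x := .of_norm_bounded ha fun x =>
    (norm_mul_le _ _).trans (mul_le_of_le_one_right (norm_nonneg _) (hnorm x))
  refine ⟨b.1 w, fun y => ?_⟩
  have h2 := hs.hasSum.mapL
    ((lp.evalCLM ℂ (fun _ : G => H) 1 y).comp <|
      (ContinuousLinearMap.apply ℂ _ (b.1 w)).comp (TranslationCommutant G H).toSubmodule.subtypeL)
  have h3 : (∑' x, a x * c x).1 (b.1 w) = w :=
    congrArg (fun r : TranslationCommutant G H => r.1 w) hb
  have h4 : (∑' x, a x * c x).1 (b.1 w) y = w y :=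
    congrArg (fun v : lp (fun _ : G => H) 1 => v y) h3
  rw [← h4]
  exact h2

end TranslationCommutant

section Twisted

variable {n : ℕ} (σ : (Fin n → ℤ) → (Fin n → ℤ) → ℂ) (hσ : ∀ x y, ‖σ x y‖ = 1)

/-- The unitary `h ↦ δ_x ♮ h` on `ℓ²(ℤⁿ)`. -/
def leftShift (x : Fin n → ℤ) : Ltwo n →L[ℂ] Ltwo n :=
  lpPermCLM 2 ENNReal.ofNat_ne_top (Equiv.subRight x) (fun y => σ x (y - x) • .id ℂ ℂ) 1
    zero_le_one fun y => by simp [norm_smul, hσ]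

/-- The unitary `h ↦ h ♮ δ_x` on `ℓ²(ℤⁿ)`. -/
def rightShift (x : Fin n → ℤ) : Ltwo n →L[ℂ] Ltwo n :=
  lpPermCLM 2 ENNReal.ofNat_ne_top (Equiv.subRight x) (fun y => σ (y - x) x • .id ℂ ℂ) 1
    zero_le_one fun y => by simp [norm_smul, hσ]

/-- Multiplication by a unimodular function on `ℓ²(ℤⁿ)`. -/
def modulation (χ : (Fin n → ℤ) → ℂ) (hχ : ∀ x, ‖χ x‖ = 1) : Ltwo n →L[ℂ] Ltwo n :=
  lpPermCLM 2 ENNReal.ofNat_ne_top (Equiv.refl _) (fun y => χ y • .id ℂ ℂ) 1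
    zero_le_one fun y => by simp [norm_smul, hχ]

theorem leftShift_apply (x : Fin n → ℤ) (h : Ltwo n) (y : Fin n → ℤ) :
    leftShift σ hσ x h y = σ x (y - x) * h (y - x) := rfl

theorem rightShift_apply (x : Fin n → ℤ) (h : Ltwo n) (y : Fin n → ℤ) :
    rightShift σ hσ x h y = σ (y - x) x * h (y - x) := rfl

theorem norm_leftShift_le (x : Fin n → ℤ) : ‖leftShift σ hσ x‖ ≤ 1 :=
  norm_lpPermCLM_le _ _ _ _ _

theorem summable_smul_leftShift {f : (Fin n → ℤ) → ℂ} (hf : Summable fun x => ‖f x‖) :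
    Summable fun x => f x • leftShift σ hσ x :=
  .of_norm_bounded hf fun x => by
    rw [norm_smul]
    exact mul_le_of_le_one_right (norm_nonneg _) (norm_leftShift_le σ hσ x)

/-- The twisted convolution operator `λ(f) : h ↦ f ♮ h` on `ℓ²(ℤⁿ)`. -/
def convOp (f : (Fin n → ℤ) → ℂ) : Ltwo n →L[ℂ] Ltwo n := ∑' x, f x • leftShift σ hσ x

theorem convOp_apply {f : (Fin n → ℤ) → ℂ} (hf : Summable fun x => ‖f x‖) (h : Ltwo n)
    (y : Fin n → ℤ) : convOp σ hσ f h y = tconv σ f h y := by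
  have := (summable_smul_leftShift σ hσ hf).hasSum.mapL
    ((lp.evalCLM ℂ (fun _ : Fin n → ℤ => ℂ) 2 y).comp (ContinuousLinearMap.apply ℂ _ h))
  refine this.tsum_eq.symm.trans (tsum_congr fun x => ?_)
  change f x * (σ x (y - x) * h (y - x)) = _
  ring

theorem convOp_comp_rightShift
    (hcoc : ∀ x y z, σ x y * σ (x + y) z = σ x (y + z) * σ y z)
    {f : (Fin n → ℤ) → ℂ} (hf : Summable fun x => ‖f x‖) (z : Fin n → ℤ) :
    convOp σ hσ f * rightShift σ hσ z = rightShift σ hσ z * convOp σ hσ f := by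
  rw [convOp, ← (summable_smul_leftShift σ hσ hf).tsum_mul_right,
    ← (summable_smul_leftShift σ hσ hf).tsum_mul_left]
  refine tsum_congr fun x => ?_
  rw [smul_mul_assoc, mul_smul_comm]
  congr 1
  refine ContinuousLinearMap.ext fun h => lp.ext <| funext fun y => ?_
  simp only [mul_apply_eq_comp, leftShift_apply, rightShift_apply]
  have := hcoc x (y - x - z) z
  rw [sub_add_cancel, show x + (y - x - z) = y - z by abel] at this
  rw [sub_right_comm y z x]
  linear_combination -(h (y - x - z)) * this

theorem rightShift_single_zero (h0 : ∀ x, σ 0 x = 1) (z : Fin n → ℤ) (c : ℂ) :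
    rightShift σ hσ z (lp.single 2 0 c) = lp.single 2 z c := by
  refine lp.ext <| funext fun y => ?_
  rw [rightShift_apply, lp.single_apply, lp.single_apply]
  by_cases hy : y = z
  · subst hy; simp [h0]
  · simp [sub_eq_zero, hy]

theorem coe_single_zero_one : ⇑(lp.single 2 0 1 : Ltwo n) = delta 0 := by
  funext y
  simp [lp.single_apply, Pi.single_apply, delta]

theorem tconv_delta_zero (h0 : ∀ x, σ x 0 = 1) (f : (Fin n → ℤ) → ℂ) :
    tconv σ f (delta 0) = f := by
  funext y
  rw [tconv, tsum_eq_single y]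
  · simp [delta, h0]
  · intro x hx
    simp [delta, sub_eq_zero, hx.symm]

/-- Conjugating `λ(f)` with a character modulates `f`. -/
theorem modulation_mul_convOp {f : (Fin n → ℤ) → ℂ} (hf : Summable fun x => ‖f x‖)
    (χ : (Fin n → ℤ) → ℂ) (hadd : ∀ x y, χ (x + y) = χ x * χ y) (hχ : ∀ x, ‖χ x‖ = 1) :
    modulation χ hχ * convOp σ hσ f = convOp σ hσ (fun x => χ x * f x) * modulation χ hχ := by
  have hf' : Summable fun x => ‖χ x * f x‖ := by simpa [hχ] using hf
  rw [convOp, convOp, ← (summable_smul_leftShift σ hσ hf).tsum_mul_left,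
    ← (summable_smul_leftShift σ hσ hf').tsum_mul_right]
  refine tsum_congr fun x => ?_
  rw [smul_mul_assoc, mul_smul_comm, mul_comm (χ x), mul_smul]
  congr 1
  refine ContinuousLinearMap.ext fun h => lp.ext <| funext fun y => ?_
  change χ y * (σ x (y - x) * h (y - x)) = χ x * (σ x (y - x) * (χ (y - x) * h (y - x)))
  rw [← add_sub_cancel x y, hadd, add_sub_cancel]
  ring

theorem modulation_mul_modulation_inv (χ : (Fin n → ℤ) → ℂ) (hχ : ∀ x, ‖χ x‖ = 1)
    (hχ' : ∀ x, ‖(χ x)⁻¹‖ = 1) :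
    modulation χ hχ * modulation (fun x => (χ x)⁻¹) hχ' = 1 := by
  refine ContinuousLinearMap.ext fun h => lp.ext <| funext fun y => ?_
  change χ y * ((χ y)⁻¹ * h y) = h y
  rw [mul_inv_cancel_left₀]
  exact norm_ne_zero_iff.1 (by simp [hχ])

/-- If `λ(f)` is right invertible on `ℓ²`, then `f` has a right `♮`-inverse in `ℓ¹`. -/
theorem exists_summable_tconv_eq_delta {f : (Fin n → ℤ) → ℂ} (hf : Summable fun x => ‖f x‖)
    (B : Ltwo n →L[ℂ] Ltwo n) (hB : convOp σ hσ f * B = 1) :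
    ∃ g : (Fin n → ℤ) → ℂ, Summable (fun x => ‖g x‖) ∧ tconv σ f g = delta 0 := by
  have hS : Summable fun x => ‖f x • leftShift σ hσ x‖ :=
    hf.of_nonneg_of_le (fun _ => norm_nonneg _) fun x => by
      rw [norm_smul]
      exact mul_le_of_le_one_right (norm_nonneg _) (norm_leftShift_le σ hσ x)
  obtain ⟨v, hv⟩ := exists_hasSum_of_forall_character _ hS (fun χ hadd hχ => by
      have hχ' : ∀ x, ‖(χ x)⁻¹‖ = 1 := fun x => by simp [hχ]
      refine ⟨modulation χ hχ * B * modulation (fun x => (χ x)⁻¹) hχ', ?_⟩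
      have : ∑' x, χ x • f x • leftShift σ hσ x = convOp σ hσ fun x => χ x * f x :=
        tsum_congr fun x => (mul_smul _ _ _).symm
      rw [this, ← mul_assoc, ← mul_assoc, ← modulation_mul_convOp σ hσ hf χ hadd hχ,
        mul_assoc _ _ B, hB, mul_one, modulation_mul_modulation_inv])
    (lp.single 1 0 (lp.single 2 0 1))
  refine ⟨fun y => v y y, ?_, funext fun y => ?_⟩
  · have hv : Summable fun y => ‖v y‖ := by
      simpa using (lp.memℓp v).summable (by simp)
    exact hv.of_nonneg_of_le (fun _ => norm_nonneg _)
      fun y => lp.norm_apply_le_norm (by simp) (v y) y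
  · have h1 := ((hv y).mapL (lp.evalCLM ℂ (fun _ : Fin n → ℤ => ℂ) 2 y)).tsum_eq
    have h2 : (lp.single 1 0 (lp.single 2 0 1) : lp (fun _ : Fin n → ℤ => Ltwo n) 1) y y =
        delta 0 y := by
      by_cases hy : y = 0
      · subst hy; simp [delta]
      · simp [delta, hy]
    refine Eq.trans (tsum_congr fun x => ?_) (h1.trans h2)
    change f x * v (y - x) (y - x) * σ x (y - x) = f x * (σ x (y - x) * v (y - x) (y - x))
    ring

end Twisted

/-- Wiener's lemma for twisted convolution by a normalized cocycle. -/
theorem exists_summable_tconv_inverse {n : ℕ} (σ : (Fin n → ℤ) → (Fin n → ℤ) → ℂ)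
    (hσ : ∀ x y, ‖σ x y‖ = 1)
    (hcoc : ∀ x y z, σ x y * σ (x + y) z = σ x (y + z) * σ y z)
    (hl : ∀ x, σ 0 x = 1) (hr : ∀ x, σ x 0 = 1)
    {f : (Fin n → ℤ) → ℂ} (hf : Summable fun x => ‖f x‖)
    (T : Ltwo n ≃L[ℂ] Ltwo n) (hT : ∀ (h : Ltwo n) x, T h x = tconv σ f h x) :
    ∃ g : (Fin n → ℤ) → ℂ, Summable (fun x => ‖g x‖) ∧
      tconv σ f g = delta 0 ∧ tconv σ g f = delta 0 ∧
      ∀ (h : Ltwo n) x, T.symm h x = tconv σ g h x := by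
  have hTf : convOp σ hσ f = T := ContinuousLinearMap.ext fun h => lp.ext <| funext fun y => by
    rw [convOp_apply σ hσ hf, ContinuousLinearEquiv.coe_coe, hT]
  obtain ⟨g, hg, hfg⟩ := exists_summable_tconv_eq_delta σ hσ hf T.symm <| by
    rw [hTf]
    exact T.coe_comp_coe_symm
  have hzero : ∀ {k : (Fin n → ℤ) → ℂ}, Summable (fun x => ‖k x‖) →
      ⇑(convOp σ hσ k (lp.single 2 0 1)) = k := fun hk => funext fun y => by
    rw [convOp_apply σ hσ hk, coe_single_zero_one, tconv_delta_zero σ hr]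
  have hprod : convOp σ hσ f * convOp σ hσ g = 1 := by
    refine lp.ext_continuousLinearMap ENNReal.ofNat_ne_top fun z =>
      ContinuousLinearMap.ext_ring ?_
    change (convOp σ hσ f * convOp σ hσ g) (lp.single 2 z 1) = lp.single 2 z 1
    rw [← rightShift_single_zero σ hσ hl z, ← mul_apply_eq_comp, mul_assoc,
      convOp_comp_rightShift σ hσ hcoc hg, ← mul_assoc, convOp_comp_rightShift σ hσ hcoc hf,
      mul_assoc, mul_apply_eq_comp]
    congr 1
    refine lp.ext <| funext fun y => ?_
    rw [mul_apply_eq_comp, convOp_apply σ hσ hf, hzero hg, hfg, coe_single_zero_one]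
  have hsymm : ∀ h, T.symm h = convOp σ hσ g h := fun h => by
    rw [T.symm_apply_eq, ← ContinuousLinearEquiv.coe_coe, ← hTf, ← mul_apply_eq_comp,
      hprod]
    rfl
  refine ⟨g, hg, hfg, ?_, fun h y => by rw [hsymm, convOp_apply σ hσ hg]⟩
  funext y
  have := convOp_apply σ hσ hg (convOp σ hσ f (lp.single 2 0 1)) y
  rw [hzero hf, ← hsymm, hTf, ContinuousLinearEquiv.coe_coe, T.symm_apply_apply,
    coe_single_zero_one] at this
  exact this.symm

section Cocycle

variable {n : ℕ} {θ : Fin n → Fin n → ℂ}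

theorem norm_coc (hθ : ∀ j k, ‖θ j k‖ = 1) (l m : Fin n → ℤ) : ‖coc θ l m‖ = 1 := by
  simp [coc, norm_prod, norm_zpow, hθ]

theorem coc_add_left (hθ : ∀ j k, θ j k ≠ 0) (l l' m : Fin n → ℤ) :
    coc θ (l + l') m = coc θ l m * coc θ l' m := by
  simp only [coc, ← Finset.prod_mul_distrib]
  refine Finset.prod_congr rfl fun p _ => ?_
  rw [Pi.add_apply, add_mul, zpow_add₀ (hθ _ _)]

theorem coc_add_right (hθ : ∀ j k, θ j k ≠ 0) (l m m' : Fin n → ℤ) :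
    coc θ l (m + m') = coc θ l m * coc θ l m' := by
  simp only [coc, ← Finset.prod_mul_distrib]
  refine Finset.prod_congr rfl fun p _ => ?_
  rw [Pi.add_apply, mul_add, zpow_add₀ (hθ _ _)]

end Cocycle

/-- ℓ¹(ℤⁿ, θ) is inverse-closed in C*(θ): if f ∈ ℓ¹ and the twisted
convolution operator λ(f) : g ↦ f ♮ g is invertible as a bounded operator on ℓ²(ℤⁿ)
(expressed by a continuous linear equivalence T acting as λ(f)), then f has a
two-sided ♮-inverse g ∈ ℓ¹(ℤⁿ), and λ(f)⁻¹ = λ(g). -/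
theorem statement6 {n : ℕ} (θ : Fin n → Fin n → ℂ)
    (hUnit : ∀ j k, ‖θ j k‖ = 1)
    (hHerm : ∀ j k, θ k j = starRingEnd ℂ (θ j k))
    (hDiag : ∀ j, θ j j = 1)
    (f : (Fin n → ℤ) → ℂ)
    (hf : Summable (fun x => ‖f x‖))
    (T : Ltwo n ≃L[ℂ] Ltwo n)
    (hT : ∀ (h : Ltwo n) (x : Fin n → ℤ), (T h : (Fin n → ℤ) → ℂ) x = tconv (coc θ) f (⇑h) x) :
    ∃ g : (Fin n → ℤ) → ℂ, Summable (fun x => ‖g x‖) ∧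
      tconv (coc θ) f g = delta 0 ∧ tconv (coc θ) g f = delta 0 ∧
      ∀ (h : Ltwo n) (x : Fin n → ℤ),
        (T.symm h : (Fin n → ℤ) → ℂ) x = tconv (coc θ) g (⇑h) x := by
  have hne : ∀ j k, θ j k ≠ 0 := fun j k => norm_ne_zero_iff.1 (by simp [hUnit])
  refine exists_summable_tconv_inverse (coc θ) (norm_coc hUnit) (fun x y z => ?_)
    (fun x => by simp [coc]) (fun x => by simp [coc]) hf T hT
  rw [coc_add_left hne, coc_add_right hne]
  ring
end
end

section
/- Let v : ℤⁿ → [1,∞) be a submultiplicative symmetric weight satisfying the GRS-condition, i.e. lim_{m→∞} v(mx)^{1/m} = 1 for every x ∈ ℤⁿ. If f ∈ ℓ¹_v(ℤⁿ) and the operator λ(f) : g ↦ f ♮ g is invertible as a bounded operator on ℓ²(ℤⁿ), then there exists g ∈ ℓ¹_v(ℤⁿ) with f ♮ g = g ♮ f = δ_0. (This is the 'if' direction of the characterization: ℓ¹_v(ℤⁿ, θ) is inverse-closed in C*(θ) when v satisfies the GRS-condition.) -/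
open scoped BigOperators
open Filter Topology

noncomputable section

theorem Ideal.exists_sub_algebraMap_mem_of_central {A : Type*} [NormedRing A] [NormedAlgebra ℂ A]
    [CompleteSpace A] (L : Ideal A) [hL : L.IsMaximal] {z : A} (hz : ∀ a, z * a = a * z) :
    ∃ c : ℂ, z - algebraMap ℂ A c ∈ L := by
  have : Nontrivial (A ⧸ L) := Submodule.Quotient.nontrivial_iff.2 hL.ne_top
  have : IsSimpleModule A (A ⧸ L) := isSimpleModule_iff_isCoatom.2 hL.out
  let r : ∀ w : A, (∀ a, w * a = a * w) → ((A ⧸ L) →ₗ[A] (A ⧸ L)) := fun w hw =>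
    L.mapQ L (LinearMap.toSpanSingleton A A w) (fun l hl => by
      simpa [hw l] using (hw l) ▸ L.mul_mem_left w hl)
  have hr : ∀ w hw a, r w hw (Submodule.Quotient.mk a) = Submodule.Quotient.mk (a * w) :=
    fun w hw a => rfl
  let φ : (A ⧸ L) →L[ℂ] (A ⧸ L) :=
    { (r z hz).restrictScalars ℂ with
      cont := by
        refine L.isQuotientMap_mkQ.continuous_iff.2 ?_
        exact L.isQuotientMap_mkQ.continuous.comp (continuous_mul_const z) }
  obtain ⟨c, hc⟩ := spectrum.nonempty φ
  have hcomm : ∀ a, (z - algebraMap ℂ A c) * a = a * (z - algebraMap ℂ A c) := fun a => by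
    rw [sub_mul, mul_sub, hz, Algebra.commutes]
  refine ⟨c, ?_⟩
  rcases (r _ hcomm).bijective_or_eq_zero with h | h
  · exfalso
    apply hc
    rw [spectrum.mem_resolventSet_iff, ← IsUnit.neg_iff, neg_sub,
      ContinuousLinearMap.isUnit_iff_bijective]
    convert h using 1
    ext x
    induction x using Submodule.Quotient.induction_on with | _ a =>
    change (Submodule.Quotient.mk (a * z - c • a) : A ⧸ L) =
      Submodule.Quotient.mk (a * (z - algebraMap ℂ A c))
    rw [mul_sub, ← Algebra.commutes, ← Algebra.smul_def]
  · have := hr _ hcomm 1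
    rw [h, one_mul] at this
    exact (Submodule.Quotient.mk_eq_zero L).1 this.symm

/-- A submultiplicative weight on an additive group, with values in `[1, ∞)`. -/
class IsSubmulWeight {G : Type*} [AddCommGroup G] (v : G → ℝ) : Prop where
  one_le : ∀ x, 1 ≤ v x
  map_add_le : ∀ x y, v (x + y) ≤ v x * v y

/-- Finitely supported functions on `G` with values in `B`, carrying the convolution product and
the `ℓ¹`-seminorm weighted by `v`. -/
def WeightedGroupRing (B : Type*) [NormedRing B] {G : Type*} (_v : G → ℝ) : Type _ :=
  AddMonoidAlgebra B G

theorem IsSubmulWeight.nonneg {G : Type*} [AddCommGroup G] (v : G → ℝ) [IsSubmulWeight v] (x : G) :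
    0 ≤ v x :=
  zero_le_one.trans (IsSubmulWeight.one_le x)

namespace WeightedGroupRing

section weightedSum

variable {G B : Type*} [NormedRing B] (v : G → ℝ)

/-- The weighted `ℓ¹`-norm of a finitely supported function. -/
def weightedSum (a : AddMonoidAlgebra B G) : ℝ := a.coeff.sum fun x b => ‖b‖ * v x

theorem weightedSum_single (x : G) (b : B) :
    weightedSum v (AddMonoidAlgebra.single x b) = ‖b‖ * v x := by
  simp [weightedSum, AddMonoidAlgebra.coeff_single]

theorem weightedSum_neg (a : AddMonoidAlgebra B G) : weightedSum v (-a) = weightedSum v a := by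
  simp [weightedSum, Finsupp.sum]

theorem weightedSum_smul_le [NormedAlgebra ℂ B] (hv : ∀ x, 0 ≤ v x) (c : ℂ)
    (a : AddMonoidAlgebra B G) : weightedSum v (c • a) ≤ ‖c‖ * weightedSum v a := by
  unfold weightedSum
  rw [AddMonoidAlgebra.coeff_smul, Finsupp.sum_of_support_subset _ Finsupp.support_smul _ (by simp),
    Finsupp.sum, Finset.mul_sum]
  refine Finset.sum_le_sum fun x _ => ?_
  rw [Finsupp.smul_apply, ← mul_assoc]
  exact mul_le_mul_of_nonneg_right (norm_smul_le _ _) (hv x)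

variable [AddCommGroup G] [IsSubmulWeight v]

theorem weightedSum_add_le (a b : AddMonoidAlgebra B G) :
    weightedSum v (a + b) ≤ weightedSum v a + weightedSum v b := by
  classical
  unfold weightedSum
  rw [AddMonoidAlgebra.coeff_add,
    Finsupp.sum_of_support_subset _ Finsupp.support_add _ (by simp),
    Finsupp.sum_of_support_subset a.coeff Finset.subset_union_left _ (by simp),
    Finsupp.sum_of_support_subset b.coeff Finset.subset_union_right _ (by simp),
    ← Finset.sum_add_distrib]
  refine Finset.sum_le_sum fun x _ => ?_
  rw [← add_mul]
  exact mul_le_mul_of_nonneg_right (norm_add_le _ _) (IsSubmulWeight.nonneg v x)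

theorem weightedSum_mul_le (a b : AddMonoidAlgebra B G) :
    weightedSum v (a * b) ≤ weightedSum v a * weightedSum v b := by
  have key : ∀ {ι : Type _} (s : Finset ι) (F : ι → AddMonoidAlgebra B G),
      weightedSum v (∑ i ∈ s, F i) ≤ ∑ i ∈ s, weightedSum v (F i) := fun s F =>
    Finset.le_sum_of_subadditive _ (by simp [weightedSum]) (weightedSum_add_le v) s F
  rw [AddMonoidAlgebra.mul_def]
  refine (key _ _).trans ?_
  rw [weightedSum, Finsupp.sum, Finset.sum_mul]
  refine Finset.sum_le_sum fun x _ => (key _ _).trans ?_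
  rw [weightedSum, Finsupp.sum, Finset.mul_sum]
  refine Finset.sum_le_sum fun y _ => ?_
  rw [weightedSum_single]
  calc ‖a.coeff x * b.coeff y‖ * v (x + y)
      ≤ (‖a.coeff x‖ * ‖b.coeff y‖) * (v x * v y) :=
        mul_le_mul (norm_mul_le _ _) (IsSubmulWeight.map_add_le x y)
          (IsSubmulWeight.nonneg v _) (by positivity)
    _ = _ := by ring

end weightedSum

variable {G : Type*} [AddCommGroup G] {B : Type*} [NormedRing B] (v : G → ℝ)

instance : Ring (WeightedGroupRing B v) := inferInstanceAs (Ring (AddMonoidAlgebra B G))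

instance [NormedAlgebra ℂ B] : Algebra ℂ (WeightedGroupRing B v) :=
  inferInstanceAs (Algebra ℂ (AddMonoidAlgebra B G))

variable [IsSubmulWeight v]

instance : SeminormedRing (WeightedGroupRing B v) :=
  RingSeminorm.toSeminormedRing
    { toFun := weightedSum v
      map_zero' := by change weightedSum v (0 : AddMonoidAlgebra B G) = 0; simp [weightedSum]
      add_le' := weightedSum_add_le v
      neg' := weightedSum_neg v
      mul_le' := weightedSum_mul_le v }

/-- The function supported at `x` with value `b`. -/
def single (x : G) (b : B) : WeightedGroupRing B v := AddMonoidAlgebra.single x b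

theorem norm_single (x : G) (b : B) : ‖single v x b‖ = ‖b‖ * v x := weightedSum_single v x b

instance [NormedAlgebra ℂ B] : NormedAlgebra ℂ (WeightedGroupRing B v) where
  norm_smul_le c a := weightedSum_smul_le v (IsSubmulWeight.nonneg v) c a

end WeightedGroupRing

/-- The weighted convolution algebra `ℓ¹_v(G, B)`, as the completion of the finitely supported
functions. -/
abbrev WeightedL1 (B : Type*) [NormedRing B] [NormedAlgebra ℂ B] {G : Type*} [AddCommGroup G]
    (v : G → ℝ) [IsSubmulWeight v] : Type _ :=
  UniformSpace.Completion (WeightedGroupRing B v)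

namespace WeightedL1

variable {G : Type*} [AddCommGroup G] {B : Type*} [NormedRing B] [NormedAlgebra ℂ B]
  (v : G → ℝ) [hv : IsSubmulWeight v]

instance : NormedAlgebra ℂ (WeightedL1 B v) where
  norm_smul_le := norm_smul_le

/-- The element of `ℓ¹_v(G, B)` supported at `x` with value `b`. -/
def mono (x : G) (b : B) : WeightedL1 B v :=
  ((WeightedGroupRing.single v x b : WeightedGroupRing B v) : WeightedL1 B v)

theorem norm_mono (x : G) (b : B) : ‖mono v x b‖ = ‖b‖ * v x := by
  rw [mono, UniformSpace.Completion.norm_coe, WeightedGroupRing.norm_single]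

theorem mono_mul_mono (x y : G) (b c : B) : mono v x b * mono v y c = mono v (x + y) (b * c) := by
  unfold mono
  rw [← UniformSpace.Completion.coe_mul]
  exact congrArg _ (AddMonoidAlgebra.single_mul_single x y b c)

theorem mono_zero_one : mono v (0 : G) (1 : B) = 1 := rfl

theorem mono_add (x : G) (b c : B) : mono v x (b + c) = mono v x b + mono v x c := by
  unfold mono
  rw [← UniformSpace.Completion.coe_add]
  exact congrArg _ (AddMonoidAlgebra.single_add x b c)

theorem mono_smul (x : G) (r : ℂ) (b : B) : mono v x (r • b) = r • mono v x b := by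
  unfold mono
  rw [← UniformSpace.Completion.coe_smul]
  exact congrArg _ (AddMonoidAlgebra.smul_single r x b).symm

/-- `mono v x` as a continuous linear map. -/
def monoL (x : G) : B →L[ℂ] WeightedL1 B v :=
  LinearMap.mkContinuous
    { toFun := mono v x, map_add' := mono_add v x, map_smul' := mono_smul v x } (v x) fun b => by
      change ‖mono v x b‖ ≤ _
      rw [norm_mono, mul_comm]

theorem monoL_apply (x : G) (b : B) : monoL v x b = mono v x b := rfl

variable {v} in
theorem induction_mono {P : WeightedL1 B v → Prop} (hP : IsClosed {c | P c})
    (hmono : ∀ x b, P (mono v x b)) (hadd : ∀ c d, P c → P d → P (c + d)) (c : WeightedL1 B v) :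
    P c := by
  induction c using UniformSpace.Completion.induction_on with
  | hp => exact hP
  | ih a =>
    let Q : AddMonoidAlgebra B G → Prop := fun a =>
      P ((show WeightedGroupRing B v from a : WeightedGroupRing B v) : WeightedL1 B v)
    refine AddMonoidAlgebra.induction_linear (motive := Q) a ?_ ?_ hmono
    · have := hmono 0 0
      rwa [← monoL_apply, map_zero] at this
    · intro a b ha hb
      have := hadd _ _ ha hb
      rwa [← UniformSpace.Completion.coe_add] at this

theorem exists_extension {E : Type*} [NormedAddCommGroup E] [NormedSpace ℂ E] [CompleteSpace E]
    (φ : G → B →ₗ[ℂ] E) (hφ : ∀ x b, ‖φ x b‖ ≤ ‖b‖ * v x) :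
    ∃ F : WeightedL1 B v →L[ℂ] E, ∀ x b, F (mono v x b) = φ x b := by
  let f : WeightedGroupRing B v →ₗ[ℂ] E :=
    (Finsupp.lsum ℂ φ) ∘ₗ
      (AddMonoidAlgebra.coeffLinearEquiv ℂ : AddMonoidAlgebra B G ≃ₗ[ℂ] _).toLinearMap
  have hf : ∀ a, f a = (a : AddMonoidAlgebra B G).coeff.sum fun x b => φ x b := fun a => rfl
  have hbound : ∀ a, ‖f a‖ ≤
      1 * ‖(UniformSpace.Completion.toComplL (𝕜 := ℂ) a : WeightedL1 B v)‖ := by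
    intro a
    rw [one_mul, UniformSpace.Completion.coe_toComplL, UniformSpace.Completion.norm_coe, hf]
    exact (norm_sum_le _ _).trans (Finset.sum_le_sum fun x _ => hφ x _)
  have hd : DenseRange (UniformSpace.Completion.toComplL (𝕜 := ℂ) (E := WeightedGroupRing B v)) :=
    UniformSpace.Completion.denseRange_coe
  refine ⟨f.extendOfNorm (UniformSpace.Completion.toComplL (𝕜 := ℂ)).toLinearMap, fun x b => ?_⟩
  refine (LinearMap.extendOfNorm_eq hd ⟨1, hbound⟩ (WeightedGroupRing.single v x b)).trans ?_
  rw [hf]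
  exact Finsupp.sum_single_index (map_zero _)

section Characters

variable (L : Ideal (WeightedL1 B v)) [hL : L.IsMaximal]

include hL in
theorem eq_of_algebraMap_sub_mem {c d : ℂ}
    (h : algebraMap ℂ (WeightedL1 B v) c - algebraMap ℂ (WeightedL1 B v) d ∈ L) : c = d := by
  by_contra hcd
  refine hL.ne_top (L.eq_top_iff_one.2 ?_)
  have := L.mul_mem_left (algebraMap ℂ _ (c - d)⁻¹) h
  rwa [← map_sub, ← map_mul, inv_mul_cancel₀ (sub_ne_zero.2 hcd), map_one] at this

theorem norm_le_of_mono_sub_algebraMap_mem [NormOneClass B] {x : G} {c : ℂ}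
    (h : mono v x (1 : B) - algebraMap ℂ _ c ∈ L) : ‖c‖ ≤ v x := by
  by_contra! hlt
  have hpos : 0 < ‖c‖ := (IsSubmulWeight.nonneg v x).trans_lt hlt
  have hc : c ≠ 0 := norm_pos_iff.1 hpos
  refine hL.ne_top (L.eq_top_of_norm_lt_one
    (x := 1 - algebraMap ℂ _ c⁻¹ * mono v x (1 : B)) ?_ ?_)
  · have := L.mul_mem_left (-algebraMap ℂ _ c⁻¹) h
    rw [mul_sub, neg_mul, neg_mul, ← map_mul, inv_mul_cancel₀ hc, map_one] at this
    convert this using 1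
    abel
  · rw [sub_sub_cancel, ← Algebra.smul_def, norm_smul, norm_mono, norm_one, one_mul, norm_inv,
      inv_mul_lt_one₀ hpos]
    exact hlt

theorem exists_addChar_of_isMaximal [NormOneClass B]
    (hGRS : ∀ x : G, Tendsto (fun m : ℕ => (v (m • x)) ^ ((m : ℝ)⁻¹)) atTop (𝓝 1)) :
    ∃ χ : AddChar G ℂ, (∀ x, ‖χ x‖ = 1) ∧ ∀ x, mono v x (1 : B) - algebraMap ℂ _ (χ x) ∈ L := by
  have hcentral : ∀ x c, mono v x (1 : B) * c = c * mono v x (1 : B) := fun x c =>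
    induction_mono (P := fun c => mono v x (1 : B) * c = c * mono v x (1 : B))
      (isClosed_eq (by fun_prop) (by fun_prop))
      (fun y b => by rw [mono_mul_mono, mono_mul_mono, one_mul, mul_one, add_comm])
      (fun c d hc hd => by rw [mul_add, add_mul, hc, hd]) c
  choose χ hχ using fun x => L.exists_sub_algebraMap_mem_of_central (hcentral x)
  have hzero : χ 0 = 1 := by
    refine (eq_of_algebraMap_sub_mem v L ?_).symm
    rw [map_one, ← mono_zero_one]
    exact hχ 0
  have hadd : ∀ x y, χ (x + y) = χ x * χ y := fun x y => by
    refine (eq_of_algebraMap_sub_mem v L ?_).symm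
    have h1 := L.mul_mem_left (mono v x (1 : B)) (hχ y)
    have h2 := L.mul_mem_left (algebraMap ℂ _ (χ y)) (hχ x)
    have h3 := L.sub_mem (hχ (x + y)) (L.add_mem h1 h2)
    rw [mul_sub, mul_sub, mono_mul_mono, one_mul, Algebra.commutes (χ y) (mono v x 1),
      ← map_mul, mul_comm (χ y)] at h3
    convert h3 using 1
    abel
  let ψ : AddChar G ℂ := ⟨χ, hzero, hadd⟩
  have hle : ∀ x, ‖ψ x‖ ≤ 1 := fun x => by
    refine ge_of_tendsto (hGRS x) ((eventually_gt_atTop 0).mono fun m hm => ?_)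
    have h := norm_le_of_mono_sub_algebraMap_mem v L (hχ (m • x))
    rw [show χ (m • x) = ψ x ^ m from ψ.map_nsmul_eq_pow m x, norm_pow] at h
    have hm' : m ≠ 0 := hm.ne'
    calc ‖ψ x‖ = (‖ψ x‖ ^ m) ^ ((m : ℝ)⁻¹) := (Real.pow_rpow_inv_natCast (norm_nonneg _) hm').symm
      _ ≤ _ := Real.rpow_le_rpow (by positivity) h (by positivity)
  refine ⟨ψ, fun x => (hle x).antisymm ?_, hχ⟩
  have h : ‖ψ x‖ * ‖ψ (-x)‖ = 1 := by
    rw [← norm_mul, ← AddChar.map_add_eq_mul, add_neg_cancel, AddChar.map_zero_eq_one, norm_one]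
  nlinarith [hle x, hle (-x), norm_nonneg (ψ x), norm_nonneg (ψ (-x))]

theorem sub_mono_zero_mem {χ : AddChar G ℂ}
    (hχ : ∀ x, mono v x (1 : B) - algebraMap ℂ _ (χ x) ∈ L) (E : WeightedL1 B v →L[ℂ] B)
    (hE : ∀ x b, E (mono v x b) = χ x • b) (c : WeightedL1 B v) : c - mono v 0 (E c) ∈ L := by
  simp only [← monoL_apply]
  refine induction_mono (P := fun c => c - monoL v 0 (E c) ∈ L) ?_ ?_ ?_ c
  · have hc : IsClosed (L : Set (WeightedL1 B v)) := inferInstance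
    exact hc.preimage (f := fun c => c - monoL v 0 (E c)) (by fun_prop)
  · intro x b
    have h := L.mul_mem_left (mono v 0 b) (hχ x)
    rwa [mul_sub, mono_mul_mono, zero_add, mul_one, ← Algebra.commutes, ← Algebra.smul_def,
      ← mono_smul, ← hE x b] at h
  · intro c d hc hd
    have := L.add_mem hc hd
    rw [map_add, map_add]
    convert this using 1
    abel

end Characters

/-- Allan's local principle for `ℓ¹_v(G, B)`. -/
theorem exists_left_inverse [NormOneClass B]
    (hGRS : ∀ x : G, Tendsto (fun m : ℕ => (v (m • x)) ^ ((m : ℝ)⁻¹)) atTop (𝓝 1))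
    [CompleteSpace B] (a : WeightedL1 B v)
    (ha : ∀ χ : AddChar G ℂ, (∀ x, ‖χ x‖ = 1) → ∀ E : WeightedL1 B v →L[ℂ] B,
      (∀ x b, E (mono v x b) = χ x • b) → ∃ b, b * E a = 1) :
    ∃ c, c * a = 1 := by
  by_contra hne
  have hspan : Ideal.span {a} ≠ ⊤ := fun h => hne <| by
    have := h ▸ Submodule.mem_top (x := (1 : WeightedL1 B v)) (R := WeightedL1 B v)
    simpa [Ideal.mem_span_singleton'] using this
  obtain ⟨L, hL, haL⟩ := Ideal.exists_le_maximal _ hspan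
  obtain ⟨χ, hχ1, hχ⟩ := exists_addChar_of_isMaximal v L hGRS
  obtain ⟨E, hE⟩ := exists_extension v (fun x => χ x • (LinearMap.id : B →ₗ[ℂ] B)) fun x b => by
    rw [LinearMap.smul_apply, LinearMap.id_apply, norm_smul, hχ1, one_mul]
    exact le_mul_of_one_le_right (norm_nonneg _) (IsSubmulWeight.one_le x)
  obtain ⟨b, hb⟩ := ha χ hχ1 E hE
  have h1 := L.sub_mem (haL (Ideal.mem_span_singleton_self a)) (sub_mono_zero_mem v L hχ E hE a)
  rw [sub_sub_cancel] at h1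
  have h2 := L.mul_mem_left (mono v 0 b) h1
  rw [mono_mul_mono, hb, zero_add, mono_zero_one] at h2
  exact hL.ne_top (L.eq_top_iff_one.2 h2)

end WeightedL1

theorem norm_entry_le {G : Type*} [DecidableEq G]
    (b : lp (fun _ : G => ℂ) 2 →L[ℂ] lp (fun _ : G => ℂ) 2) (u w : G) :
    ‖b (lp.single 2 w 1) u‖ ≤ ‖b‖ :=
  (lp.norm_apply_le_norm two_ne_zero _ u).trans <| (b.le_opNorm _).trans_eq <| by
    rw [lp.norm_single two_pos, norm_one, mul_one]

section WeightedShift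

variable {G : Type*} [AddCommGroup G]

theorem sum_norm_mul_shift_rpow_le (x : G) {m : G → ℂ} {C : ℝ} (hm : ∀ u, ‖m u‖ ≤ C)
    (h : lp (fun _ : G => ℂ) 2) (s : Finset G) :
    ∑ u ∈ s, ‖m u * h (u - x)‖ ^ (2 : ENNReal).toReal ≤ (C * ‖h‖) ^ (2 : ENNReal).toReal := by
  classical
  have hC : 0 ≤ C := (norm_nonneg _).trans (hm 0)
  have h2 : 0 < (2 : ENNReal).toReal := by norm_num
  calc ∑ u ∈ s, ‖m u * h (u - x)‖ ^ (2 : ENNReal).toReal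
      ≤ ∑ u ∈ s, C ^ (2 : ENNReal).toReal * ‖h (u - x)‖ ^ (2 : ENNReal).toReal := by
        refine Finset.sum_le_sum fun u _ => ?_
        rw [norm_mul, Real.mul_rpow (norm_nonneg _) (norm_nonneg _)]
        gcongr
        exact hm u
    _ = C ^ (2 : ENNReal).toReal * ∑ u ∈ s.image (· - x), ‖h u‖ ^ (2 : ENNReal).toReal := by
        rw [← Finset.mul_sum, Finset.sum_image fun _ _ _ _ h => sub_left_injective h]
    _ ≤ C ^ (2 : ENNReal).toReal * ‖h‖ ^ (2 : ENNReal).toReal := by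
        gcongr
        exact lp.sum_rpow_le_norm_rpow h2 h _
    _ = _ := (Real.mul_rpow hC (norm_nonneg _)).symm

/-- The operator `h ↦ (u ↦ m u * h (u - x))` on `ℓ²(G)`, for a multiplier `m` bounded by `C`. -/
def weightedShift (x : G) (m : G → ℂ) (C : ℝ) (hm : ∀ u, ‖m u‖ ≤ C) :
    lp (fun _ : G => ℂ) 2 →L[ℂ] lp (fun _ : G => ℂ) 2 :=
  LinearMap.mkContinuous
    { toFun := fun h =>
        ⟨fun u => m u * h (u - x), memℓp_gen' (sum_norm_mul_shift_rpow_le x hm h)⟩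
      map_add' := fun h k => by
        ext u
        exact mul_add _ _ _
      map_smul' := fun c h => by
        ext u
        exact mul_left_comm _ _ _ } C fun h =>
    lp.norm_le_of_forall_sum_le (by norm_num)
      (mul_nonneg ((norm_nonneg _).trans (hm 0)) (norm_nonneg _))
      (sum_norm_mul_shift_rpow_le x hm h)

theorem weightedShift_apply (x : G) (m : G → ℂ) (C : ℝ) (hm : ∀ u, ‖m u‖ ≤ C)
    (h : lp (fun _ : G => ℂ) 2) (u : G) : weightedShift x m C hm h u = m u * h (u - x) := rfl

theorem norm_weightedShift_le (x : G) (m : G → ℂ) (C : ℝ) (hm : ∀ u, ‖m u‖ ≤ C) :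
    ‖weightedShift x m C hm‖ ≤ C :=
  LinearMap.mkContinuous_norm_le _ ((norm_nonneg _).trans (hm 0))
    fun h => lp.norm_le_of_forall_sum_le (by norm_num)
      (mul_nonneg ((norm_nonneg _).trans (hm 0)) (norm_nonneg _))
      (sum_norm_mul_shift_rpow_le x hm h)

variable [DecidableEq G]

/-- The operator whose matrix is the `x`-th diagonal of the matrix of `b`. -/
def diagonalPart (x : G) : (lp (fun _ : G => ℂ) 2 →L[ℂ] lp (fun _ : G => ℂ) 2) →ₗ[ℂ]
    (lp (fun _ : G => ℂ) 2 →L[ℂ] lp (fun _ : G => ℂ) 2) where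
  toFun b := weightedShift x (fun u => b (lp.single 2 (u - x) 1) u) ‖b‖ fun u =>
    norm_entry_le b u (u - x)
  map_add' b c := by
    ext h u
    exact add_mul _ _ _
  map_smul' r b := by
    ext h u
    exact mul_assoc _ _ _

theorem diagonalPart_apply (x : G) (b : lp (fun _ : G => ℂ) 2 →L[ℂ] lp (fun _ : G => ℂ) 2)
    (h : lp (fun _ : G => ℂ) 2) (u : G) :
    diagonalPart x b h u = b (lp.single 2 (u - x) 1) u * h (u - x) := rfl

theorem norm_diagonalPart_le (x : G) (b : lp (fun _ : G => ℂ) 2 →L[ℂ] lp (fun _ : G => ℂ) 2) :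
    ‖diagonalPart x b‖ ≤ ‖b‖ :=
  norm_weightedShift_le x _ _ fun u => norm_entry_le b u (u - x)

theorem diagonalPart_zero_one :
    diagonalPart (0 : G) (1 : lp (fun _ : G => ℂ) 2 →L[ℂ] lp (fun _ : G => ℂ) 2) = 1 := by
  ext h u
  rw [diagonalPart_apply, sub_zero, one_apply_eq_self, one_apply_eq_self,
    lp.single_apply_self, one_mul]

theorem weightedShift_single (x : G) (m : G → ℂ) (C : ℝ) (hm : ∀ u, ‖m u‖ ≤ C) (y : G) :
    weightedShift x m C hm (lp.single 2 y 1) = m (x + y) • lp.single 2 (x + y) 1 := by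
  ext u
  rw [weightedShift_apply, lp.coeFn_smul, Pi.smul_apply, smul_eq_mul]
  rcases eq_or_ne u (x + y) with rfl | hu
  · rw [add_sub_cancel_left, lp.single_apply_self, lp.single_apply_self]
  · rw [lp.single_apply_ne _ _ _ hu, lp.single_apply_ne _ _ _ fun h => hu (by rw [← h]; abel),
      mul_zero, mul_zero]

theorem diagonalPart_mul_weightedShift (x y : G)
    (b : lp (fun _ : G => ℂ) 2 →L[ℂ] lp (fun _ : G => ℂ) 2) (m : G → ℂ) (C : ℝ)
    (hm : ∀ u, ‖m u‖ ≤ C) :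
    diagonalPart (x + y) (b * weightedShift y m C hm) =
      diagonalPart x b * weightedShift y m C hm := by
  ext h u
  rw [mul_apply_eq_comp, diagonalPart_apply, diagonalPart_apply, weightedShift_apply,
    mul_apply_eq_comp, weightedShift_single, map_smul, lp.coeFn_smul, Pi.smul_apply,
    show y + (u - (x + y)) = u - x by abel, show u - (x + y) = u - x - y by abel, smul_eq_mul]
  ring

end WeightedShift

/-- A bimultiplicative function on an additive group with values in the unit circle. -/
structure IsUnitaryBichar {G : Type*} [AddCommGroup G] (σ : G → G → ℂ) : Prop where
  norm_eq : ∀ x y, ‖σ x y‖ = 1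
  add_left : ∀ x y z, σ (x + y) z = σ x z * σ y z
  add_right : ∀ x y z, σ x (y + z) = σ x y * σ x z

namespace IsUnitaryBichar

variable {G : Type*} [AddCommGroup G] {σ : G → G → ℂ} (hσ : IsUnitaryBichar σ)
include hσ

theorem ne_zero (x y : G) : σ x y ≠ 0 := norm_ne_zero_iff.1 (by rw [hσ.norm_eq]; exact one_ne_zero)

theorem zero_left (y : G) : σ 0 y = 1 := by
  have h := hσ.add_left 0 0 y
  rw [add_zero] at h
  exact (mul_eq_left₀ (hσ.ne_zero 0 y)).1 h.symm

theorem zero_right (x : G) : σ x 0 = 1 := by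
  have h := hσ.add_right x 0 0
  rw [add_zero] at h
  exact (mul_eq_left₀ (hσ.ne_zero x 0)).1 h.symm

/-- The left twisted translation `δ_u ↦ σ(x, u) δ_{x+u}` on `ℓ²(G)`. -/
def leftShift (x : G) : lp (fun _ : G => ℂ) 2 →L[ℂ] lp (fun _ : G => ℂ) 2 :=
  weightedShift x (fun u => σ x (u - x)) 1 fun _ => (hσ.norm_eq _ _).le

/-- The right twisted translation `δ_u ↦ σ(u, x) δ_{u+x}` on `ℓ²(G)`. -/
def rightShift (x : G) : lp (fun _ : G => ℂ) 2 →L[ℂ] lp (fun _ : G => ℂ) 2 :=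
  weightedShift x (fun u => σ (u - x) x) 1 fun _ => (hσ.norm_eq _ _).le

theorem leftShift_apply (x : G) (h : lp (fun _ : G => ℂ) 2) (u : G) :
    hσ.leftShift x h u = σ x (u - x) * h (u - x) := rfl

theorem rightShift_apply (x : G) (h : lp (fun _ : G => ℂ) 2) (u : G) :
    hσ.rightShift x h u = σ (u - x) x * h (u - x) := rfl

theorem norm_leftShift_le (x : G) : ‖hσ.leftShift x‖ ≤ 1 := norm_weightedShift_le _ _ _ _

theorem leftShift_mul_rightShift (x y : G) :
    hσ.leftShift x * hσ.rightShift y = hσ.rightShift y * hσ.leftShift x := by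
  ext h u
  rw [mul_apply_eq_comp, mul_apply_eq_comp, leftShift_apply,
    rightShift_apply, rightShift_apply, leftShift_apply, show u - y - x = u - x - y by abel]
  have h1 : σ x (u - x) = σ x (u - x - y) * σ x y := by rw [← hσ.add_right, sub_add_cancel]
  have h2 : σ (u - y) y = σ (u - x - y) y * σ x y := by
    rw [← hσ.add_left]
    congr 1
    abel
  rw [h1, h2]
  ring

theorem summable_smul_leftShift {f : G → ℂ} (hf : Summable fun x => ‖f x‖) :
    Summable fun x => f x • hσ.leftShift x := by
  refine Summable.of_norm_bounded hf fun x => ?_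
  rw [norm_smul]
  exact mul_le_of_le_one_right (norm_nonneg _) (hσ.norm_leftShift_le x)

theorem hasSum_smul_leftShift {f : G → ℂ} (hf : Summable fun x => ‖f x‖)
    {T : lp (fun _ : G => ℂ) 2 →L[ℂ] lp (fun _ : G => ℂ) 2}
    (hT : ∀ (h : lp (fun _ : G => ℂ) 2) (x : G), T h x = ∑' y, f y * h (x - y) * σ y (x - y)) :
    HasSum (fun x => f x • hσ.leftShift x) T := by
  have hs := hσ.summable_smul_leftShift hf
  convert hs.hasSum
  ext h u
  have := (hs.hasSum.mapL ((lp.evalCLM ℂ (fun _ : G => ℂ) 2 u).comp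
    (ContinuousLinearMap.apply ℂ (lp (fun _ : G => ℂ) 2) h)))
  rw [hT]
  refine (tsum_congr fun y => ?_).trans this.tsum_eq
  change _ = f y * (σ y (u - y) * h (u - y))
  ring

/-- If `T = λ(f)`, then `T` conjugated by a character `χ` is `∑ χ(x) f(x) λ(δ_x)`. -/
theorem hasSum_smul_smul_leftShift {f : G → ℂ}
    {T : lp (fun _ : G => ℂ) 2 →L[ℂ] lp (fun _ : G => ℂ) 2}
    (hT : HasSum (fun x => f x • hσ.leftShift x) T) (χ : AddChar G ℂ) (hχ : ∀ x, ‖χ x‖ = 1) :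
    HasSum (fun x => χ x • f x • hσ.leftShift x)
      (weightedShift 0 χ 1 (fun x => (hχ x).le) * T *
        weightedShift 0 (fun x => χ (-x)) 1 (fun _ => (hχ _).le)) := by
  refine Eq.subst (motive := fun F => HasSum F _) (funext fun x => ?_)
    ((hT.mul_left _).mul_right _)
  symm
  ext h u
  change χ x * (f x * (σ x (u - x) * h (u - x))) =
    χ u * (f x * (σ x (u - 0 - x) * (χ (-(u - 0 - x)) * h (u - 0 - x - 0))))
  have : χ x = χ u * χ (-(u - x)) := by
    rw [← AddChar.map_add_eq_mul]
    congr 1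
    abel
  rw [sub_zero, sub_zero, this]
  ring

end IsUnitaryBichar

theorem weightedShift_addChar_mul_neg {G : Type*} [AddCommGroup G] (χ : AddChar G ℂ)
    (hχ : ∀ x, ‖χ x‖ = 1) :
    weightedShift 0 (fun x => χ (-x)) 1 (fun _ => (hχ _).le) *
      weightedShift 0 χ 1 (fun x => (hχ x).le) = 1 ∧
    weightedShift 0 χ 1 (fun x => (hχ x).le) *
      weightedShift 0 (fun x => χ (-x)) 1 (fun _ => (hχ _).le) = 1 := by
  have h1 : ∀ x, χ x * χ (-x) = 1 := fun x => by
    rw [← AddChar.map_add_eq_mul, add_neg_cancel, AddChar.map_zero_eq_one]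
  constructor
  · ext h u
    change χ (-u) * (χ (u - 0) * h (u - 0 - 0)) = h u
    rw [sub_zero, sub_zero, ← mul_assoc, mul_comm (χ (-u)), h1, one_mul]
  · ext h u
    change χ u * (χ (-(u - 0)) * h (u - 0 - 0)) = h u
    rw [sub_zero, sub_zero, ← mul_assoc, h1, one_mul]

section Column

variable {G : Type*} [AddCommGroup G] [DecidableEq G]

/-- The `x`-th entry of the weighted zeroth column of a matrix, as an element of `ℓ¹(G)`. -/
def weightedColumnEntry (v : G → ℝ) (x : G) :
    (lp (fun _ : G => ℂ) 2 →L[ℂ] lp (fun _ : G => ℂ) 2) →ₗ[ℂ] lp (fun _ : G => ℂ) 1 where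
  toFun b := lp.single 1 x (v x * b (lp.single 2 0 1) x)
  map_add' b c := by
    rw [← lp.single_add, ← mul_add]
    rfl
  map_smul' r b := by
    rw [RingHom.id_apply, ← lp.single_smul, smul_eq_mul, mul_left_comm]
    rfl

theorem weightedColumnEntry_apply (v : G → ℝ) (x : G)
    (b : lp (fun _ : G => ℂ) 2 →L[ℂ] lp (fun _ : G => ℂ) 2) :
    weightedColumnEntry v x b = lp.single 1 x (v x * b (lp.single 2 0 1) x) := rfl

theorem norm_weightedColumnEntry_le (v : G → ℝ) [IsSubmulWeight v] (x : G)
    (b : lp (fun _ : G => ℂ) 2 →L[ℂ] lp (fun _ : G => ℂ) 2) :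
    ‖weightedColumnEntry v x b‖ ≤ ‖b‖ * v x := by
  rw [weightedColumnEntry_apply, lp.norm_single one_pos, norm_mul, mul_comm, Complex.norm_real,
    Real.norm_eq_abs, abs_of_nonneg (IsSubmulWeight.nonneg v x)]
  exact mul_le_mul_of_nonneg_right (norm_entry_le b x 0) (IsSubmulWeight.nonneg v x)

theorem summable_extension_apply_single {v : G → ℝ} [IsSubmulWeight v]
    {Φ : WeightedL1 (lp (fun _ : G => ℂ) 2 →L[ℂ] lp (fun _ : G => ℂ) 2) v →L[ℂ]
      (lp (fun _ : G => ℂ) 2 →L[ℂ] lp (fun _ : G => ℂ) 2)}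
    (hΦ : ∀ x b, Φ (WeightedL1.mono v x b) = diagonalPart x b)
    (c : WeightedL1 (lp (fun _ : G => ℂ) 2 →L[ℂ] lp (fun _ : G => ℂ) 2) v) :
    Summable fun x => ‖Φ c (lp.single 2 0 1) x‖ * v x := by
  obtain ⟨Ψ, hΨ⟩ := WeightedL1.exists_extension v (weightedColumnEntry v)
    (norm_weightedColumnEntry_le v)
  have hΨΦ : ∀ d x, Ψ d x = v x * Φ d (lp.single 2 0 1) x := fun d x => by
    refine WeightedL1.induction_mono
      (P := fun d => Ψ d x = v x * Φ d (lp.single 2 0 1) x) (isClosed_eq ?_ ?_) ?_ ?_ d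
    · exact (lp.evalCLM ℂ (fun _ : G => ℂ) 1 x).continuous.comp Ψ.continuous
    · exact continuous_const.mul ((lp.evalCLM ℂ (fun _ : G => ℂ) 2 x).continuous.comp
        (Φ.continuous.clm_apply continuous_const))
    · intro y b
      rw [hΨ, hΦ, diagonalPart_apply, weightedColumnEntry_apply]
      rcases eq_or_ne x y with rfl | hxy
      · rw [lp.single_apply_self, sub_self, lp.single_apply_self, mul_one]
      · rw [lp.single_apply_ne _ _ _ hxy, lp.single_apply_ne _ _ _ (sub_ne_zero.2 hxy), mul_zero,
          mul_zero]
    · intro d e hd he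
      rw [map_add, map_add, add_apply, lp.coeFn_add, Pi.add_apply, hd, he,
        lp.coeFn_add, Pi.add_apply, mul_add]
  refine ((lp.memℓp (Ψ c)).summable (by norm_num)).congr fun x => ?_
  rw [hΨΦ, ENNReal.toReal_one, Real.rpow_one, norm_mul, Complex.norm_real, Real.norm_eq_abs,
    abs_of_nonneg (IsSubmulWeight.nonneg v x), mul_comm]

end Column

namespace IsUnitaryBichar

variable {G : Type*} [AddCommGroup G] [DecidableEq G] {σ : G → G → ℂ} (hσ : IsUnitaryBichar σ)
include hσ

theorem extension_mul_mono_leftShift {v : G → ℝ} [IsSubmulWeight v]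
    {Φ : WeightedL1 (lp (fun _ : G => ℂ) 2 →L[ℂ] lp (fun _ : G => ℂ) 2) v →L[ℂ]
      (lp (fun _ : G => ℂ) 2 →L[ℂ] lp (fun _ : G => ℂ) 2)}
    (hΦ : ∀ x b, Φ (WeightedL1.mono v x b) = diagonalPart x b) (y : G) (r : ℂ)
    (d : WeightedL1 (lp (fun _ : G => ℂ) 2 →L[ℂ] lp (fun _ : G => ℂ) 2) v) :
    Φ (d * WeightedL1.mono v y (r • hσ.leftShift y)) = Φ d * (r • hσ.leftShift y) := by
  refine WeightedL1.induction_mono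
    (P := fun d => Φ (d * WeightedL1.mono v y (r • hσ.leftShift y)) =
      Φ d * (r • hσ.leftShift y))
    (isClosed_eq (Φ.continuous.comp (continuous_mul_const _))
      ((continuous_mul_const _).comp Φ.continuous)) ?_ ?_ d
  · intro x b
    rw [WeightedL1.mono_mul_mono, hΦ, hΦ, mul_smul_comm, mul_smul_comm, map_smul]
    congr 1
    exact diagonalPart_mul_weightedShift _ _ _ _ _ _
  · intro d e hd he
    rw [add_mul, map_add, map_add, add_mul, hd, he]

theorem summable_inverse_apply_single (v : G → ℝ) [IsSubmulWeight v]
    (hGRS : ∀ x : G, Tendsto (fun m : ℕ => (v (m • x)) ^ ((m : ℝ)⁻¹)) atTop (𝓝 1))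
    {f : G → ℂ} (hf : Summable fun x => ‖f x‖ * v x)
    {S T : lp (fun _ : G => ℂ) 2 →L[ℂ] lp (fun _ : G => ℂ) 2} (hST : S * T = 1) (hTS : T * S = 1)
    (hT : HasSum (fun x => f x • hσ.leftShift x) T) :
    Summable fun x => ‖S (lp.single 2 0 1) x‖ * v x := by
  have : Nontrivial (lp (fun _ : G => ℂ) 2) :=
    ⟨lp.single 2 0 1, 0, norm_ne_zero_iff.1 (by rw [lp.norm_single two_pos]; simp)⟩
  have hsum : Summable fun x => WeightedL1.mono v x (f x • hσ.leftShift x) := by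
    refine Summable.of_norm_bounded hf fun x => ?_
    rw [WeightedL1.norm_mono, norm_smul]
    refine mul_le_mul_of_nonneg_right ?_ (IsSubmulWeight.nonneg v x)
    exact mul_le_of_le_one_right (norm_nonneg _) (hσ.norm_leftShift_le x)
  obtain ⟨c, hc⟩ := WeightedL1.exists_left_inverse v hGRS
      (∑' x, WeightedL1.mono v x (f x • hσ.leftShift x)) fun χ hχ E hE => by
    obtain ⟨h1, h2⟩ := weightedShift_addChar_mul_neg χ hχ
    set M := weightedShift 0 χ 1 (fun x => (hχ x).le)
    set M' := weightedShift 0 (fun x => χ (-x)) 1 (fun _ => (hχ _).le)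
    have hET := hsum.hasSum.mapL E
    simp only [hE] at hET
    rw [hET.unique (hσ.hasSum_smul_smul_leftShift hT χ hχ)]
    refine ⟨M * S * M', ?_⟩
    calc M * S * M' * (M * T * M') = M * S * (M' * M) * T * M' := by simp only [mul_assoc]
      _ = M * (S * T) * M' := by rw [h1]; simp only [mul_assoc, one_mul]
      _ = 1 := by rw [hST, mul_one, h2]
  obtain ⟨Φ, hΦ⟩ := WeightedL1.exists_extension v diagonalPart fun x b =>
    (norm_diagonalPart_le x b).trans
      (le_mul_of_one_le_right (norm_nonneg _) (IsSubmulWeight.one_le x))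
  have hΦT : Φ c * T = 1 := by
    have h1 := (hsum.hasSum.mul_left c).mapL Φ
    simp only [hσ.extension_mul_mono_leftShift hΦ] at h1
    rw [(hT.mul_left (Φ c)).unique h1, hc, ← WeightedL1.mono_zero_one, hΦ, diagonalPart_zero_one]
  rw [← left_inv_eq_right_inv hΦT hTS]
  exact summable_extension_apply_single hΦ c

/-- The inverse of `λ(f)` commutes with right twisted translations, hence is determined by its
value at `δ_0`. -/
theorem inverse_apply_single {f : G → ℂ}
    {S T : lp (fun _ : G => ℂ) 2 →L[ℂ] lp (fun _ : G => ℂ) 2} (hST : S * T = 1) (hTS : T * S = 1)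
    (hT : HasSum (fun x => f x • hσ.leftShift x) T) (w : G) :
    S (lp.single 2 w 1) = hσ.rightShift w (S (lp.single 2 0 1)) := by
  have hTR : T * hσ.rightShift w = hσ.rightShift w * T := by
    refine (hT.mul_right _).unique ?_
    convert hT.mul_left (hσ.rightShift w) using 2 with x
    rw [mul_smul_comm, smul_mul_assoc, hσ.leftShift_mul_rightShift]
  have hSR : S * hσ.rightShift w = hσ.rightShift w * S := by
    calc S * hσ.rightShift w = S * (hσ.rightShift w * T) * S := by
          rw [mul_assoc, mul_assoc, hTS, mul_one]
      _ = S * T * hσ.rightShift w * S := by rw [← hTR, mul_assoc S T]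
      _ = _ := by rw [hST, one_mul]
  have hR : hσ.rightShift w (lp.single 2 0 1) = lp.single 2 w 1 := by
    refine (weightedShift_single _ _ _ _ _).trans ?_
    rw [add_zero, sub_self, hσ.zero_left, one_smul]
  rw [← hR]
  exact congrArg (fun A : lp (fun _ : G => ℂ) 2 →L[ℂ] lp (fun _ : G => ℂ) 2 =>
    A (lp.single 2 0 1)) hSR

theorem tsum_inverse_apply_single_mul {f : G → ℂ}
    {S T : lp (fun _ : G => ℂ) 2 →L[ℂ] lp (fun _ : G => ℂ) 2} (hST : S * T = 1) (hTS : T * S = 1)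
    (hT : HasSum (fun x => f x • hσ.leftShift x) T) (x : G) :
    ∑' y, S (lp.single 2 0 1) y * f (x - y) * σ y (x - y) = if x = 0 then 1 else 0 := by
  have h0 : HasSum (fun y => f y • lp.single 2 y (1 : ℂ)) (T (lp.single 2 0 (1 : ℂ))) := by
    have h := hT.mapL (ContinuousLinearMap.apply ℂ (lp (fun _ : G => ℂ) 2) (lp.single 2 0 1))
    rw [ContinuousLinearMap.apply_apply] at h
    convert h using 2 with y
    rw [ContinuousLinearMap.apply_apply, smul_apply]
    rw [leftShift, weightedShift_single, add_zero, sub_self, hσ.zero_right, one_smul]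
  have h1 := h0.mapL ((lp.evalCLM ℂ (fun _ : G => ℂ) 2 x).comp S)
  have h2 : S (T (lp.single 2 0 1)) = lp.single 2 0 1 := by
    rw [← mul_apply_eq_comp, hST, one_apply_eq_self]
  rw [← (Equiv.subLeft x).tsum_eq]
  have h3 : ((lp.evalCLM ℂ (fun _ : G => ℂ) 2 x).comp S) (T (lp.single 2 0 1)) =
      if x = 0 then 1 else 0 := by
    change S (T (lp.single 2 0 1)) x = _
    rw [h2]
    split_ifs with hx
    · rw [hx, lp.single_apply_self]
    · rw [lp.single_apply_ne _ _ _ hx]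
  rw [← h3, ← h1.tsum_eq]
  refine tsum_congr fun y => ?_
  change _ = S (f y • lp.single 2 y 1) x
  rw [map_smul, hσ.inverse_apply_single hST hTS hT y, lp.coeFn_smul, Pi.smul_apply,
    rightShift_apply, Equiv.subLeft_apply, sub_sub_cancel, smul_eq_mul]
  ring

end IsUnitaryBichar

theorem isUnitaryBichar_coc {n : ℕ} {θ : Fin n → Fin n → ℂ} (hθ : ∀ j k, ‖θ j k‖ = 1) :
    IsUnitaryBichar (coc θ) where
  norm_eq l m := by
    rw [coc, norm_prod]
    exact Finset.prod_eq_one fun p _ => by rw [norm_zpow, hθ, one_zpow]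
  add_left l l' m := by
    rw [coc, coc, coc, ← Finset.prod_mul_distrib]
    refine Finset.prod_congr rfl fun p _ => ?_
    rw [Pi.add_apply, add_mul, zpow_add₀ (norm_ne_zero_iff.1 (by rw [hθ]; exact one_ne_zero))]
  add_right l m m' := by
    rw [coc, coc, coc, ← Finset.prod_mul_distrib]
    refine Finset.prod_congr rfl fun p _ => ?_
    rw [Pi.add_apply, mul_add, zpow_add₀ (norm_ne_zero_iff.1 (by rw [hθ]; exact one_ne_zero))]

/-- if the submultiplicative symmetric weight v satisfies the
GRS-condition lim_m v(mx)^{1/m} = 1, then ℓ¹_v(ℤⁿ, θ) is inverse-closed in C*(θ):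
any f ∈ ℓ¹_v whose operator λ(f) is invertible on ℓ²(ℤⁿ) has a two-sided
♮-inverse in ℓ¹_v. -/
theorem statement7 {n : ℕ} (θ : Fin n → Fin n → ℂ)
    (hUnit : ∀ j k, ‖θ j k‖ = 1)
    (hHerm : ∀ j k, θ k j = starRingEnd ℂ (θ j k))
    (hDiag : ∀ j, θ j j = 1)
    (v : (Fin n → ℤ) → ℝ)
    (hv1 : ∀ x, 1 ≤ v x)
    (hvsub : ∀ x y, v (x + y) ≤ v x * v y)
    (hvsymm : ∀ x, v (-x) = v x)
    (hGRS : ∀ x : Fin n → ℤ,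
      Filter.Tendsto (fun m : ℕ => (v (m • x)) ^ ((m : ℝ)⁻¹)) atTop (𝓝 1))
    (f : (Fin n → ℤ) → ℂ)
    (hf : Summable (fun x => ‖f x‖ * v x))
    (T : Ltwo n ≃L[ℂ] Ltwo n)
    (hT : ∀ (h : Ltwo n) (x : Fin n → ℤ), (T h : (Fin n → ℤ) → ℂ) x = tconv (coc θ) f (⇑h) x) :
    ∃ g : (Fin n → ℤ) → ℂ, Summable (fun x => ‖g x‖ * v x) ∧
      tconv (coc θ) f g = delta 0 ∧ tconv (coc θ) g f = delta 0 := by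
  have : IsSubmulWeight v := ⟨hv1, hvsub⟩
  have hσ := isUnitaryBichar_coc hUnit
  have hf1 : Summable fun x => ‖f x‖ := hf.of_nonneg_of_le (fun _ => norm_nonneg _)
    fun x => le_mul_of_one_le_right (norm_nonneg _) (hv1 x)
  have hsum := hσ.hasSum_smul_leftShift (T := (T : Ltwo n →L[ℂ] Ltwo n)) hf1 hT
  have hTS : (T : Ltwo n →L[ℂ] Ltwo n) * (T.symm : Ltwo n →L[ℂ] Ltwo n) = 1 :=
    T.coe_comp_coe_symm
  have hST : (T.symm : Ltwo n →L[ℂ] Ltwo n) * (T : Ltwo n →L[ℂ] Ltwo n) = 1 :=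
    T.coe_symm_comp_coe
  have hsummable := hσ.summable_inverse_apply_single v hGRS hf hST hTS hsum
  refine ⟨T.symm (lp.single 2 0 1), hsummable, ?_, ?_⟩
  · funext x
    rw [← hT, T.apply_symm_apply, delta]
    split_ifs with hx
    · rw [hx, lp.single_apply_self]
    · rw [lp.single_apply_ne _ _ _ hx]
  · funext x
    exact hσ.tsum_inverse_apply_single_mul hST hTS hsum x
end
end
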